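/- arXiv:2501.12513 — 2 statements merged into one kernel-verified Lean document; each statement's English description precedes it below -/
import Mathlib

section
/- Let 0 < q < 1, σ ∈ S_k fixed, and π ∼ Maj(n,q) (the distribution on S_n with P(π) = q^{maj π}/[n]_q!). Let T_σ(π) count occurrences of the pattern σ in π. Then E[T_σ(π)] = C(n,k) · q^{maj(σ)} / [k]_q!. -/
/-- The major index of a word `w` of length `N`. -/
def wmaj {N : ℕ} {α : Type*} [LinearOrder α] (w : Fin N → α) : ℕ :=
  ∑ i ∈ Finset.range (N - 1),
    if h : i + 1 < N then
      (if w ⟨i + 1, h⟩ < w ⟨i, Nat.lt_of_succ_lt h⟩ then i + 1 else 0)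
    else 0

/-- The major index of a permutation. -/
def maj {n : ℕ} (π : Equiv.Perm (Fin n)) : ℕ := wmaj (fun i => π i)

/-- The `q`-integer `[m]_q = 1 + q + ⋯ + q^{m-1}`. -/
def qint (q : ℝ) (m : ℕ) : ℝ := ∑ j ∈ Finset.range m, q ^ j

/-- The `q`-factorial `[n]_q! = ∏_{i=1}^n [i]_q`. -/
def qfact (q : ℝ) (n : ℕ) : ℝ := ∏ i ∈ Finset.range n, qint q (i + 1)

/-- `patternCount σ π` is the number of occurrences of the pattern `σ ∈ S_k` in
`π ∈ Sₙ`: strictly monotone index tuples `f : Fin k → Fin n` such that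
`(π (f 1), …, π (f k))` is order-isomorphic to `σ`. -/
def patternCount {k n : ℕ} (σ : Equiv.Perm (Fin k)) (π : Equiv.Perm (Fin n)) : ℕ :=
  (Finset.univ.filter (fun f : Fin k → Fin n =>
    StrictMono f ∧ ∀ a b : Fin k, σ a < σ b ↔ π (f a) < π (f b))).card

/-- Major index of the reverse of a list. -/
def rmaj {α : Type*} [LinearOrder α] : List α → ℕ
  | [] => 0
  | [_] => 0
  | y :: z :: t => (if y < z then t.length + 1 else 0) + rmaj (z :: t)

theorem rmaj_ofFn {α : Type*} [LinearOrder α] : ∀ {N : ℕ} (w : Fin N → α),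
    rmaj (List.ofFn w).reverse = wmaj w
  | 0, w => by simp [rmaj, wmaj]
  | 1, w => by simp [rmaj, wmaj]
  | N + 2, w => by
    have ih := rmaj_ofFn (fun i : Fin (N + 1) => w i.castSucc)
    rw [List.ofFn_succ', List.concat_eq_append, List.reverse_append]
    rw [List.ofFn_succ', List.concat_eq_append, List.reverse_append] at ih ⊢
    simp only [List.reverse_singleton, List.singleton_append] at ih ⊢
    rw [rmaj, ih]
    unfold wmaj
    have e : N + 2 - 1 = N + 1 := rfl
    have e' : N + 1 - 1 = N := rfl
    rw [e, e', Finset.sum_range_succ, add_comm]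
    congr 1
    · apply Finset.sum_congr rfl
      intro i hi
      have := Finset.mem_range.1 hi
      have h1 : i + 1 < N + 2 := by omega
      have h2 : i + 1 < N + 1 := by omega
      simp only [h1, h2, dif_pos]
      rfl
    · have h1 : N + 1 < N + 2 := by omega
      simp only [h1, dif_pos, List.length_reverse, List.length_ofFn]
      rfl

theorem wmaj_comp {N : ℕ} {α β : Type*} [LinearOrder α] [LinearOrder β] (w : Fin N → α)
    (g : α → β) (hg : StrictMono g) : wmaj (fun i => g (w i)) = wmaj w := by
  unfold wmaj
  simp only [hg.lt_iff_lt]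

theorem length_ins {α : Type*} (x : α) :
    ∀ (w l : List α), l ∈ w.permutations'Aux x → l.length = w.length + 1
  | [], l, h => by
    simp only [List.permutations'Aux, List.mem_singleton] at h
    subst h; simp
  | y :: t, l, h => by
    simp only [List.permutations'Aux, List.mem_cons, List.mem_map] at h
    rcases h with rfl | ⟨s, hs, rfl⟩
    · simp
    · simp [length_ins x t s hs]

theorem insertion {α : Type*} [LinearOrder α] (q : ℝ) (x : α) : ∀ (w : List α), w.Nodup → x ∉ w →
    ((w.permutations'Aux x).map (fun l => q ^ rmaj l)).sum = q ^ rmaj w * qint q (w.length + 1)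
  | [], _, _ => by simp [List.permutations'Aux, rmaj, qint]
  | [z], _, hx => by
    have hxz : x ≠ z := by simpa using hx
    rcases lt_or_gt_of_ne hxz with h | h
    · simp [List.permutations'Aux, rmaj, qint, Finset.sum_range_succ, h, h.not_gt, add_comm]
    · simp [List.permutations'Aux, rmaj, qint, Finset.sum_range_succ, h, h.not_gt]
  | y :: z :: t, hw, hx => by
    have ih := insertion q x (z :: t) (List.nodup_cons.1 hw).2 (fun h => hx (List.mem_cons_of_mem _ h))
    have hyz : y ≠ z := by
      intro h; subst h; simp at hw
    have hxy : x ≠ y := by intro h; subst h; simp at hx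
    have hxz : x ≠ z := by intro h; subst h; simp at hx
    have key : ((t.permutations'Aux x).map (fun l => q ^ rmaj (y :: z :: l))).sum
        = q ^ (if y < z then t.length + 2 else 0) *
          ((t.permutations'Aux x).map (fun l => q ^ rmaj (z :: l))).sum := by
      rw [← List.sum_map_mul_left]
      congr 1
      apply List.map_congr_left
      intro l hl
      have hlen : l.length = t.length + 1 := by
        exact length_ins x t l hl
      rw [rmaj, pow_add, hlen]
    have e1 : qint q (t.length + 1 + 1 + 1) = qint q (t.length + 1 + 1) + q ^ (t.length + 2) :=
      Finset.sum_range_succ _ _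
    have e2 : qint q (t.length + 1 + 1 + 1) = q * qint q (t.length + 1 + 1) + 1 := by
      unfold qint
      rw [Finset.sum_range_succ', Finset.mul_sum]
      simp [pow_succ']
    simp only [List.permutations'Aux, List.map_cons, List.map_map, List.sum_cons,
      Function.comp_def, List.length_cons] at ih ⊢
    rw [key]
    simp only [rmaj, List.length_cons] at ih ⊢
    generalize ((t.permutations'Aux x).map (fun l => q ^ rmaj (z :: l))).sum = S at *
    generalize rmaj (z :: t) = r at *
    generalize t.length = m at *
    generalize qint q (m + 1 + 1) = Q at *
    generalize qint q (m + 1 + 1 + 1) = Q' at *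
    rcases lt_or_gt_of_ne hxy with h1 | h1 <;> rcases lt_or_gt_of_ne hxz with h2 | h2 <;>
      rcases lt_or_gt_of_ne hyz with h3 | h3 <;>
      simp only [h1, h2, h3, h1.not_gt, h2.not_gt, h3.not_gt, if_true, if_false, zero_add,
        pow_zero, one_mul] at ih ⊢ <;>
      first
      | (exfalso; order)
      | linear_combination q ^ (m + 2) * ih - q ^ r * q ^ (m + 1) * e2
      | linear_combination ih - q ^ r * e1

theorem ins_filter {α : Type*} (p : α → Bool) (x : α) (hx : p x = false) :
    ∀ (w l : List α), l ∈ w.permutations'Aux x → l.filter p = w.filter p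
  | [], l, h => by
    simp only [List.permutations'Aux, List.mem_singleton] at h
    subst h; simp [hx]
  | y :: t, l, h => by
    simp only [List.permutations'Aux, List.mem_cons, List.mem_map] at h
    rcases h with rfl | ⟨s, hs, rfl⟩
    · simp [hx]
    · have := ins_filter p x hx t s hs
      simp [List.filter_cons, this]

theorem nodup_perms' {α : Type*} {l : List α} (h : l.Nodup) : l.permutations'.Nodup :=
  (List.permutations_perm_permutations' l).nodup_iff.1 (List.nodup_permutations l h)

theorem sum_flatMap_real {β : Type*} (f : β → List ℝ) (l : List β) :
    (l.flatMap f).sum = (l.map (fun b => (f b).sum)).sum := by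
  induction l with
  | nil => simp
  | cons a t ih => simp [ih]

theorem main_sum {α : Type*} [LinearOrder α] (q : ℝ) (u : List α) : ∀ (xs : List α),
    (xs ++ u).Nodup →
    ((xs ++ u).permutations'.map
      (fun l => if l.filter (fun a => decide (a ∈ u)) = u then q ^ rmaj l else 0)).sum * qfact q u.length
      = q ^ rmaj u * qfact q (xs.length + u.length)
  | [], h => by
    simp only [List.nil_append, List.length_nil, zero_add] at h ⊢
    congr 1
    have : ∀ l ∈ u.permutations', (if l.filter (fun a => decide (a ∈ u)) = u then q ^ rmaj l else 0)
        = if l = u then q ^ rmaj l else 0 := by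
      intro l hl
      have hp := List.mem_permutations'.1 hl
      rw [List.filter_eq_self.2 (fun a ha => by simpa using hp.subset ha)]
    rw [List.map_congr_left this,
      ← List.sum_toFinset _ (nodup_perms' h), Finset.sum_ite_eq']
    simp [List.mem_permutations']
  | x :: xs, h => by
    rw [List.cons_append, List.nodup_cons] at h
    have ih := main_sum q u xs h.2
    have hxu : x ∉ u := fun hh => h.1 (List.mem_append_right _ hh)
    rw [List.cons_append, List.permutations', List.map_flatMap, sum_flatMap_real]
    have : ∀ w ∈ (xs ++ u).permutations',
        ((w.permutations'Aux x).map
          (fun l => if l.filter (fun a => decide (a ∈ u)) = u then q ^ rmaj l else 0)).sum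
        = (if w.filter (fun a => decide (a ∈ u)) = u then q ^ rmaj w else 0)
          * qint q (xs.length + u.length + 1) := by
      intro w hw
      have hp := List.mem_permutations'.1 hw
      have hwn : w.Nodup := hp.nodup_iff.2 h.2
      have hxw : x ∉ w := fun hh => h.1 (hp.subset hh)
      have hlen : w.length = xs.length + u.length := by simpa using hp.length_eq
      have e : ∀ l ∈ w.permutations'Aux x,
          (if l.filter (fun a => decide (a ∈ u)) = u then q ^ rmaj l else 0)
          = (if w.filter (fun a => decide (a ∈ u)) = u then 1 else 0) * q ^ rmaj l := by
        intro l hl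
        rw [ins_filter _ x (by simpa using hxu) w l hl]
        split_ifs <;> simp
      rw [List.map_congr_left e, List.sum_map_mul_left, insertion q x w hwn hxw, hlen]
      split_ifs <;> simp
    rw [List.map_congr_left this, List.sum_map_mul_right, mul_right_comm, ih]
    have : (x :: xs).length + u.length = xs.length + u.length + 1 := by simp; omega
    rw [this, qfact, qfact, Finset.prod_range_succ, mul_assoc]

theorem sum_perm {n : ℕ} (L : List (Fin n)) (hL : L.Perm (List.finRange n))
    (F : List (Fin n) → ℝ) :
    ∑ π : Equiv.Perm (Fin n), F (List.ofFn (fun i => π i)).reverse = (L.permutations'.map F).sum := by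
  have hLn : L.Nodup := hL.nodup_iff.2 (List.nodup_finRange n)
  rw [← List.sum_toFinset _ (nodup_perms' hLn)]
  have hinj : Function.Injective
      (fun π : Equiv.Perm (Fin n) => (List.ofFn (fun i => π i)).reverse) := by
    intro a b h
    have := List.ofFn_injective (List.reverse_injective h)
    exact Equiv.ext (fun i => congrFun this i)
  have him : Finset.univ.image
      (fun π : Equiv.Perm (Fin n) => (List.ofFn (fun i => π i)).reverse) = L.permutations'.toFinset := by
    apply Finset.eq_of_subset_of_card_le
    · intro l hl
      simp only [Finset.mem_image, Finset.mem_univ, true_and] at hl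
      obtain ⟨π, rfl⟩ := hl
      rw [List.mem_toFinset, List.mem_permutations']
      refine (List.reverse_perm _).trans (List.Perm.trans ?_ hL.symm)
      rw [List.perm_ext_iff_of_nodup (List.nodup_ofFn.2 π.injective) (List.nodup_finRange n)]
      intro a
      simp only [List.mem_ofFn, List.mem_finRange, iff_true]
      exact π.surjective a
    · rw [Finset.card_image_of_injective _ hinj, List.toFinset_card_of_nodup
        (nodup_perms' hLn), Finset.card_univ, Fintype.card_perm, Fintype.card_fin,
        (List.permutations_perm_permutations' L).symm.length_eq, List.length_permutations,
        hL.length_eq, List.length_finRange]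
  rw [← him, Finset.sum_image (fun a _ b _ h => hinj h)]

theorem cond_iff {k n : ℕ} (π : Equiv.Perm (Fin n)) (v : Fin k → Fin n) (hv : Function.Injective v) :
    StrictMono (fun i => π.symm (v i)) ↔
      (List.ofFn (fun i => π i)).reverse.filter (fun a => decide (a ∈ (List.ofFn v).reverse))
        = (List.ofFn v).reverse := by
  rw [List.filter_reverse, List.reverse_inj]
  have e1 : List.ofFn (fun i => π i) = (List.finRange n).map π := by
    rw [List.ofFn_eq_map]
  have e2 : List.ofFn v = (List.ofFn (fun i => π.symm (v i))).map π := by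
    rw [List.map_ofFn]; congr 1; ext i; simp
  have hh : Function.Injective (fun i => π.symm (v i)) := π.symm.injective.comp hv
  rw [e1, List.filter_map]
  conv_lhs => skip
  conv in (_ = List.ofFn v) => rhs; rw [e2]
  rw [(List.map_injective_iff.2 π.injective).eq_iff]
  rw [← List.sortedLT_ofFn_iff]
  constructor
  · intro h
    refine List.Perm.eq_of_sortedLE ?_ ?_ ?_
    · exact (((List.pairwise_lt_finRange n).filter _).sortedLT).sortedLE
    · exact h.sortedLE
    · rw [List.perm_ext_iff_of_nodup ((List.nodup_finRange n).filter _) (List.nodup_ofFn.2 hh)]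
      intro a
      simp [List.mem_ofFn, Equiv.symm_apply_eq]
  · intro h
    rw [← h]
    exact ((List.pairwise_lt_finRange n).filter _).sortedLT

theorem card_strictMono (k n : ℕ) :
    (Finset.univ.filter (fun g : Fin k → Fin n => StrictMono g)).card = n.choose k := by
  rw [show n.choose k = ((Finset.univ : Finset (Fin n)).powersetCard k).card by
    rw [Finset.card_powersetCard, Finset.card_univ, Fintype.card_fin]]
  refine Finset.card_bij (fun g _ => Finset.univ.image g) ?_ ?_ ?_
  · intro g hg
    have hg := (Finset.mem_filter.1 hg).2
    rw [Finset.mem_powersetCard]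
    refine ⟨Finset.subset_univ _, ?_⟩
    rw [Finset.card_image_of_injective _ hg.injective, Finset.card_univ, Fintype.card_fin]
  · intro g hg g' hg' h
    have hg := (Finset.mem_filter.1 hg).2
    have hg' := (Finset.mem_filter.1 hg').2
    have : Set.range g = Set.range g' := by
      have := congrArg (fun s : Finset (Fin n) => (s : Set (Fin n))) h
      simpa using this
    exact (StrictMono.range_inj hg hg').1 this
  · intro s hs
    have hc := (Finset.mem_powersetCard.1 hs).2
    refine ⟨s.orderEmbOfFin hc, by simp [(s.orderEmbOfFin hc).strictMono], ?_⟩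
    apply Finset.coe_injective
    simp

theorem patternCount_eq {k n : ℕ} (σ : Equiv.Perm (Fin k)) (π : Equiv.Perm (Fin n)) :
    patternCount σ π = (Finset.univ.filter (fun g : Fin k → Fin n =>
      StrictMono g ∧ StrictMono (fun i => π.symm (g (σ i))))).card := by
  unfold patternCount
  refine Finset.card_bij' (fun f _ => fun i => π (f (σ.symm i)))
    (fun g _ => fun i => π.symm (g (σ i))) ?_ ?_ ?_ ?_
  · intro f hf
    have hf := (Finset.mem_filter.1 hf).2
    simp only [Finset.mem_filter, Finset.mem_univ, true_and, Equiv.symm_apply_apply]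
    refine ⟨?_, hf.1⟩
    intro a b hab
    apply (hf.2 _ _).1
    simpa using hab
  · intro g hg
    have hg := (Finset.mem_filter.1 hg).2
    simp only [Finset.mem_filter, Finset.mem_univ, true_and, Equiv.apply_symm_apply]
    exact ⟨hg.2, fun a b => hg.1.lt_iff_lt.symm⟩
  · intro f _; simp
  · intro g _; simp

theorem qfact_pos (q : ℝ) (hq0 : 0 < q) (n : ℕ) : 0 < qfact q n := by
  apply Finset.prod_pos
  intro i _
  exact Finset.sum_pos (fun j _ => pow_pos hq0 j) ⟨0, by simp⟩

theorem inner_sum_maj (q : ℝ) {k n : ℕ} (σ : Equiv.Perm (Fin k)) (g : Fin k → Fin n)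
    (hg : StrictMono g) :
    (∑ π : Equiv.Perm (Fin n),
      if StrictMono (fun i => π.symm (g (σ i))) then q ^ maj π else 0) * qfact q k
      = q ^ maj σ * qfact q n := by
  have hv : Function.Injective (fun i => g (σ i)) := hg.injective.comp σ.injective
  set u := (List.ofFn (fun i => g (σ i))).reverse with hu
  have hun : u.Nodup := List.nodup_reverse.2 (List.nodup_ofFn.2 hv)
  have hul : u.length = k := by simp [hu]
  set xs := (List.finRange n).filter (fun a => decide (a ∉ u)) with hxs
  have hnd : (xs ++ u).Nodup := by
    refine List.Nodup.append ((List.nodup_finRange n).filter _) hun ?_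
    intro a ha hb
    simp [hxs] at ha
    exact ha hb
  have hL : (xs ++ u).Perm (List.finRange n) := by
    rw [List.perm_ext_iff_of_nodup hnd (List.nodup_finRange n)]
    intro a
    simp only [hxs, List.mem_append, List.mem_filter, List.mem_finRange, true_and, iff_true,
      decide_eq_true_eq]
    tauto
  have hlen : xs.length + u.length = n := by simpa using hL.length_eq
  have h1 := main_sum q u xs hnd
  rw [← sum_perm _ hL, hlen, hul] at h1
  have h2 : rmaj u = maj σ := by
    rw [hu, rmaj_ofFn]; exact wmaj_comp _ g hg
  rw [h2] at h1
  rw [← h1]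
  congr 1
  apply Finset.sum_congr rfl
  intro π _
  rw [rmaj_ofFn]
  have := cond_iff π _ hv
  rw [← hu] at this
  simp only [this]
  rfl

/-- Under `Maj(n,q)` (where `π` has probability `q^{maj π}/[n]_q!`), the expected
number of occurrences of a fixed pattern `σ ∈ S_k` is `C(n,k) · q^{maj σ} / [k]_q!`. -/
theorem expected_pattern_count (q : ℝ) (hq0 : 0 < q) (hq1 : q < 1)
    (k n : ℕ) (hk : k ≤ n) (σ : Equiv.Perm (Fin k)) :
    ∑ π : Equiv.Perm (Fin n),
        (patternCount σ π : ℝ) * (q ^ maj π / qfact q n)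
      = (n.choose k : ℝ) * q ^ maj σ / qfact q k := by
  have hn := (qfact_pos q hq0 n).ne'
  have hk' := (qfact_pos q hq0 k).ne'
  have e : ∀ π : Equiv.Perm (Fin n), (patternCount σ π : ℝ) * (q ^ maj π / qfact q n)
      = ∑ g ∈ Finset.univ.filter (fun g : Fin k → Fin n => StrictMono g),
        (if StrictMono (fun i => π.symm (g (σ i))) then q ^ maj π else 0) / qfact q n := by
    intro π
    rw [patternCount_eq, ← Finset.filter_filter, ← Finset.sum_div, ← Finset.sum_filter,
      Finset.sum_const, nsmul_eq_mul, mul_div_assoc]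
  rw [Finset.sum_congr rfl (fun π _ => e π), Finset.sum_comm]
  have e2 : ∀ g ∈ Finset.univ.filter (fun g : Fin k → Fin n => StrictMono g),
      ∑ π : Equiv.Perm (Fin n),
        (if StrictMono (fun i => π.symm (g (σ i))) then q ^ maj π else 0) / qfact q n
      = q ^ maj σ / qfact q k := by
    intro g hg
    rw [← Finset.sum_div, div_eq_div_iff hn hk']
    exact inner_sum_maj q σ g (Finset.mem_filter.1 hg).2
  rw [Finset.sum_congr rfl e2, Finset.sum_const, card_strictMono, nsmul_eq_mul, mul_div_assoc]
end

section
/- Let 0 < q < 1 and let π ∼ Maj(n,q). Then the expected number of fixed points of π equals the finite sum ∑_{ℓ=1}^{n} (1-q)^{ℓ-1} / [ℓ]_q, where [ℓ]_q = (1-q^ℓ)/(1-q). -/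
/-- The number of fixed points of a permutation. -/
def fixedPointCount {n : ℕ} (π : Equiv.Perm (Fin n)) : ℕ :=
  (Finset.univ.filter (fun i : Fin n => π i = i)).card

lemma hasSum_mul_nonneg {β γ : Type} (f : β → ℝ) (g : γ → ℝ) (a b : ℝ) (hf : HasSum f a)
    (hg : HasSum g b) (f0 : ∀ x, 0 ≤ f x) (g0 : ∀ x, 0 ≤ g x) :
    HasSum (fun x : β × γ => f x.1 * g x.2) (a * b) :=
  hf.mul hg (hf.summable.mul_of_nonneg hg.summable f0 g0)

open Polynomial in
lemma hasSum_pi_poly (m : ℕ) (u : Fin m → ℕ → ℝ[X]) (U : Fin m → ℝ[X])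
    (h0 : ∀ j k r, 0 ≤ (u j k).coeff r)
    (h : ∀ j r, HasSum (fun k => (u j k).coeff r) ((U j).coeff r)) (r : ℕ) :
    HasSum (fun w : Fin m → ℕ => (∏ j, u j (w j)).coeff r) ((∏ j, U j).coeff r) := by
  have hnn : ∀ (m : ℕ) (u : Fin m → ℕ → ℝ[X]) (h0 : ∀ j k r, 0 ≤ (u j k).coeff r)
      (w : Fin m → ℕ) (r : ℕ), 0 ≤ (∏ j, u j (w j)).coeff r := by
    intro m
    induction m with
    | zero => intro u h0 w r; simp [coeff_one]; split_ifs <;> norm_num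
    | succ m ih =>
      intro u h0 w r
      rw [Fin.prod_univ_succ, coeff_mul]
      exact Finset.sum_nonneg fun x _ => mul_nonneg (h0 _ _ _)
        (ih (fun j => u j.succ) (fun j => h0 j.succ) (fun j => w j.succ) _)
  induction m generalizing r with
  | zero =>
    simp only [Finset.univ_eq_empty, Finset.prod_empty]
    exact hasSum_unique (fun _ : Fin 0 → ℕ => (1 : ℝ[X]).coeff r)
  | succ m ih =>
    have h1 := fun r => h 0 r
    have h2 := ih (fun j => u j.succ) (fun j => U j.succ) (fun j => h0 j.succ)
      (fun j => h j.succ)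
    have h3 : HasSum (fun y : ℕ × (Fin m → ℕ) => ∑ x ∈ Finset.HasAntidiagonal.antidiagonal r,
        (u 0 y.1).coeff x.1 * (∏ j : Fin m, u j.succ (y.2 j)).coeff x.2)
        (∑ x ∈ Finset.HasAntidiagonal.antidiagonal r, (U 0).coeff x.1 * (∏ j : Fin m, U j.succ).coeff x.2) := by
      refine hasSum_sum fun x _ => ?_
      exact hasSum_mul_nonneg (fun k => (u 0 k).coeff x.1)
        (fun w : Fin m → ℕ => (∏ j : Fin m, u j.succ (w j)).coeff x.2)
        ((U 0).coeff x.1) ((∏ j : Fin m, U j.succ).coeff x.2)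
        (h1 x.1) (h2 x.2) (fun k => h0 0 k x.1)
        (fun w => hnn m (fun j => u j.succ) (fun j => h0 j.succ) w x.2)
    have e : (fun w : Fin (m + 1) → ℕ => (∏ j, u j (w j)).coeff r)
        ∘ (Fin.consEquiv (fun _ => ℕ)) = (fun y : ℕ × (Fin m → ℕ) =>
        ∑ x ∈ Finset.HasAntidiagonal.antidiagonal r,
        (u 0 y.1).coeff x.1 * (∏ j : Fin m, u j.succ (y.2 j)).coeff x.2) := by
      ext y
      simp only [Function.comp_def, Fin.consEquiv_apply, Fin.prod_univ_succ, Fin.cons_zero,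
        Fin.cons_succ, coeff_mul]
    rw [← (Fin.consEquiv (fun _ => ℕ)).hasSum_iff, e, Fin.prod_univ_succ, coeff_mul]
    exact h3

lemma hasSum_pi_real (m : ℕ) (u : Fin m → ℕ → ℝ) (U : Fin m → ℝ)
    (h0 : ∀ j k, 0 ≤ u j k) (h : ∀ j, HasSum (u j) (U j)) :
    HasSum (fun w : Fin m → ℕ => ∏ j, u j (w j)) (∏ j, U j) := by
  have := hasSum_pi_poly m (fun j k => Polynomial.C (u j k)) (fun j => Polynomial.C (U j))
    (fun j k r => by rw [Polynomial.coeff_C]; split_ifs <;> simp [h0])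
    (fun j r => by
      simp only [Polynomial.coeff_C]
      split_ifs
      · exact h j
      · exact hasSum_zero) 0
  simpa only [← map_prod, Polynomial.coeff_C_zero] using this

open Polynomial in
lemma trace_aux (a l : ℝ) (m : ℕ) :
    ∑ i ∈ Finset.range (m + 1),
      (((1 + C a * (X - 1)) + C l * (X - 1)) ^ i * (1 + C a * (X - 1)) ^ (m - i)).coeff i
      = ∑ s ∈ Finset.range (m + 1), l ^ s := by
  set A : ℝ[X] := 1 + C a * (X - 1) with hA
  have hAd : A.natDegree ≤ 1 := by rw [hA]; compute_degree
  have hX : (X - 1 : ℝ[X]).natDegree ≤ 1 := by compute_degree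
  have e1 : ∀ i ∈ Finset.range (m + 1), ((A + C l * (X - 1)) ^ i * A ^ (m - i)).coeff i
      = ∑ s ∈ Finset.range (m + 1), l ^ s * ((i.choose s : ℝ) * ((X - 1) ^ s * A ^ (m - s)).coeff i) := by
    intro i hi
    have hi' : i ≤ m := by simpa [Nat.lt_succ_iff] using hi
    have : (A + C l * (X - 1)) ^ i * A ^ (m - i)
        = ∑ s ∈ Finset.range (m + 1), C (l ^ s * (i.choose s : ℝ)) * ((X - 1) ^ s * A ^ (m - s)) := by
      rw [add_comm A, add_pow, Finset.sum_mul]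
      rw [← Finset.sum_subset (Finset.range_mono (Nat.succ_le_succ hi'))]
      · refine Finset.sum_congr rfl fun s hs => ?_
        have hs' : s ≤ i := by simpa [Nat.lt_succ_iff] using hs
        have : m - s = (i - s) + (m - i) := by omega
        rw [this, pow_add, mul_pow, C_mul, C_pow]
        simp only [map_natCast]
        ring
      · intro s _ hs
        have : i < s := by simpa using hs
        simp [Nat.choose_eq_zero_of_lt this]
    rw [this, finsetSum_coeff]
    refine Finset.sum_congr rfl fun s _ => ?_
    rw [coeff_C_mul, mul_assoc]
  rw [Finset.sum_congr rfl e1, Finset.sum_comm]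
  refine Finset.sum_congr rfl fun s hs => ?_
  have hs' : s ≤ m := by simpa [Nat.lt_succ_iff] using hs
  rw [← Finset.mul_sum]
  suffices h : ∑ i ∈ Finset.range (m + 1), ((i.choose s : ℝ) * ((X - 1) ^ s * A ^ (m - s)).coeff i) = 1 by
    rw [h, mul_one]
  set f : ℝ[X] := (X - 1) ^ s * A ^ (m - s) with hf
  have hd : f.natDegree < m + 1 := by
    have h1 := natDegree_mul_le (p := (X - 1 : ℝ[X]) ^ s) (q := A ^ (m - s))
    have h2 := natDegree_pow_le_of_le s hX
    have h3 := natDegree_pow_le_of_le (m - s) hAd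
    rw [hf]; omega
  have t1 : ((taylor 1) f).coeff s = 1 := by
    have e : (taylor (1:ℝ)) f = (1 + C a * X) ^ (m - s) * X ^ s := by
      rw [hf, hA, taylor_mul, taylor_pow, taylor_pow]
      simp only [map_add, map_sub, taylor_mul, taylor_C, taylor_X, taylor_one, C_1]
      ring
    rw [e, coeff_mul_X_pow']
    simp [coeff_zero_eq_eval_zero]
  rw [taylor_coeff, hasseDeriv_apply, sum_over_range' _ _ (m+1) hd, eval_finsetSum] at t1
  · simpa using t1
  · simp

lemma hasSum_geo_ge (q : ℝ) (hq0 : 0 < q) (hq1 : q < 1) (k : ℕ) :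
    HasSum (fun x : ℕ => if k ≤ x then (1 - q) * q ^ x else 0) (q ^ k) := by
  have h1 : (1 - q) ≠ 0 := by linarith
  have h := ((hasSum_geometric_of_lt_one hq0.le hq1).mul_left ((1 - q) * q ^ k))
  have e : (1 - q) * q ^ k * (1 - q)⁻¹ = q ^ k := by field_simp
  rw [e] at h
  refine (Function.Injective.hasSum_iff (add_right_injective k) ?_).1 ?_
  · intro x hx
    rw [if_neg]
    intro hk
    exact hx ⟨x - k, by simp; omega⟩
  · have e : ((fun x : ℕ => if k ≤ x then (1 - q) * q ^ x else 0) ∘ fun x => k + x)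
        = fun x => (1 - q) * q ^ k * q ^ x := by
      ext x
      simp [pow_add]; ring
    rw [e]; exact h

open Polynomial in
lemma hasSum_cls (q : ℝ) (hq0 : 0 < q) (hq1 : q < 1) (k r : ℕ) :
    HasSum (fun x : ℕ => (C ((1 - q) * q ^ x) * (if k ≤ x then (X : ℝ[X]) else 1)).coeff r)
      ((C (1 - q ^ k) + C (q ^ k) * X).coeff r) := by
  have h1 := hasSum_geo_ge q hq0 hq1 k
  have h2 := hasSum_geo_ge q hq0 hq1 0
  simp only [Nat.zero_le, if_true, pow_zero] at h2
  have h3 := ((h2.sub h1).mul_right ((1 : ℝ[X]).coeff r)).add (h1.mul_right ((X : ℝ[X]).coeff r))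
  have e1 : (fun x : ℕ => (C ((1 - q) * q ^ x) * (if k ≤ x then (X : ℝ[X]) else 1)).coeff r)
      = fun b => ((1 - q) * q ^ b - if k ≤ b then (1 - q) * q ^ b else 0) * (1 : ℝ[X]).coeff r +
        (if k ≤ b then (1 - q) * q ^ b else 0) * (X : ℝ[X]).coeff r := by
    ext x
    rw [coeff_C_mul]
    split_ifs <;> simp
  have e2 : (C (1 - q ^ k) + C (q ^ k) * X : ℝ[X]).coeff r
      = (1 - q ^ k) * (1 : ℝ[X]).coeff r + q ^ k * (X : ℝ[X]).coeff r := by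
    rw [coeff_add, coeff_C_mul, ← coeff_C_mul (p := (1 : ℝ[X])), mul_one]
  rw [e1, e2]; exact h3

/-- number of indices before `i` in the stable decreasing order of `w` -/
def rk {n : ℕ} (w : Fin n → ℕ) (i : Fin n) : ℕ :=
  (Finset.univ.filter fun j : Fin n => (j < i ∧ w i ≤ w j) ∨ (i < j ∧ w i < w j)).card

open Polynomial in
lemma hasSum_fix_ik (q : ℝ) (hq0 : 0 < q) (hq1 : q < 1) (n : ℕ) (i : Fin n) (k : ℕ) :
    HasSum (fun w : Fin n → ℕ => if w i = k then
        (if rk w i = i then ∏ j, ((1 - q) * q ^ w j) else 0) else 0)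
      ((1 - q) * q ^ k * ((C (1 - q ^ k) + C (q ^ k) * X) ^ (i : ℕ)
        * (C (1 - q ^ (k + 1)) + C (q ^ (k + 1)) * X) ^ (n - 1 - i) : ℝ[X]).coeff i) := by
  set u : Fin n → ℕ → ℝ[X] := fun j x =>
    if j = i then (if x = k then C ((1 - q) * q ^ x) else 0)
    else if j < i then C ((1 - q) * q ^ x) * (if k ≤ x then X else 1)
    else C ((1 - q) * q ^ x) * (if k + 1 ≤ x then X else 1) with hu
  set U : Fin n → ℝ[X] := fun j =>
    if j = i then C ((1 - q) * q ^ k)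
    else if j < i then (C (1 - q ^ k) + C (q ^ k) * X)
    else (C (1 - q ^ (k + 1)) + C (q ^ (k + 1)) * X) with hU
  have hg : ∀ x : ℕ, 0 ≤ (1 - q) * q ^ x := fun x => mul_nonneg (by linarith) (by positivity)
  have key := hasSum_pi_poly n u U ?_ ?_ i
  · convert key using 1
    · ext w
      by_cases hw : w i = k
      · rw [if_pos hw]
        have : ∏ j, u j (w j) = C (∏ j, ((1 - q) * q ^ w j)) * X ^ rk w i := by
          rw [rk, Finset.card_filter, ← Finset.prod_pow_eq_pow_sum, map_prod,
            ← Finset.prod_mul_distrib]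
          refine Finset.prod_congr rfl fun j _ => ?_
          simp only [hu]
          rcases lt_trichotomy j i with h | h | h
          · simp only [h.ne, h, h.not_gt, if_true, if_false, hw]
            by_cases hk : k ≤ w j <;> simp [hk]
          · subst h; simp [hw]
          · simp only [h.ne', h, h.not_gt, if_false, hw, Nat.succ_le_iff]
            by_cases hk : k < w j <;> simp [hk]
        rw [this, coeff_C_mul, coeff_X_pow]
        by_cases hr : rk w i = i
        · simp [hr]
        · simp [hr, Ne.symm hr]
      · rw [if_neg hw, Finset.prod_eq_zero (Finset.mem_univ i)]
        · simp
        · simp [hu, hw]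
    · have : ∏ j, U j = C ((1 - q) * q ^ k) * ((C (1 - q ^ k) + C (q ^ k) * X) ^ (i : ℕ)
        * (C (1 - q ^ (k + 1)) + C (q ^ (k + 1)) * X) ^ (n - 1 - i)) := by
        simp only [hU]
        rw [← Finset.mul_prod_erase _ _ (Finset.mem_univ i), if_pos rfl]
        congr 1
        have e : ∀ j ∈ Finset.univ.erase i, (if j = i then C ((1 - q) * q ^ k)
            else if j < i then (C (1 - q ^ k) + C (q ^ k) * X)
            else (C (1 - q ^ (k + 1)) + C (q ^ (k + 1)) * X)) = if j < i then (C (1 - q ^ k) + C (q ^ k) * X)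
            else (C (1 - q ^ (k + 1)) + C (q ^ (k + 1)) * X) := by
          intro j hj
          rw [if_neg (Finset.ne_of_mem_erase hj)]
        rw [Finset.prod_congr rfl e, Finset.prod_ite, Finset.prod_const, Finset.prod_const]
        have e1 : (Finset.univ.erase i).filter (fun j => j < i) = Finset.Iio i := by
          ext j; simp; intro h; exact h.ne
        have e2 : (Finset.univ.erase i).filter (fun j => ¬ j < i) = Finset.Ioi i := by
          ext j; simp; constructor
          · rintro ⟨h1, h2⟩; exact lt_of_le_of_ne h2 (Ne.symm h1)
          · intro h; exact ⟨h.ne', h.le⟩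
        rw [e1, e2, Fin.card_Iio, Fin.card_Ioi]
      rw [this, coeff_C_mul]
  · intro j x r
    simp only [hu]
    split_ifs <;> simp only [mul_one, coeff_C_mul, coeff_C, coeff_X, coeff_zero] <;>
      first
      | exact le_rfl
      | (split_ifs <;> simp [hg])
  · intro j r
    by_cases h : j = i
    · simp only [hu, hU, h, if_true]
      convert hasSum_ite_eq k ((C ((1 - q) * q ^ k)).coeff r) using 2 with x
      split_ifs with hx
      · rw [hx]
      · simp
    · by_cases h' : j < i
      · simp only [hu, hU, h, h', if_true, if_false]
        exact hasSum_cls q hq0 hq1 k r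
      · simp only [hu, hU, h, h', if_false]
        exact hasSum_cls q hq0 hq1 (k+1) r

/-- the weight of a word with independent geometric letters -/
noncomputable def wt (q : ℝ) {n : ℕ} (w : Fin n → ℕ) : ℝ := ∏ j, ((1 - q) * q ^ w j)

lemma wt_nonneg (q : ℝ) (hq0 : 0 < q) (hq1 : q < 1) {n : ℕ} (w : Fin n → ℕ) : 0 ≤ wt q w :=
  Finset.prod_nonneg fun _ _ => mul_nonneg (by linarith) (by positivity)

lemma hasSum_wt (q : ℝ) (hq0 : 0 < q) (hq1 : q < 1) (n : ℕ) :
    HasSum (fun w : Fin n → ℕ => wt q w) 1 := by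
  have h := hasSum_pi_real n (fun _ k => (1 - q) * q ^ k) (fun _ => 1)
    (fun _ _ => mul_nonneg (by linarith) (by positivity))
    (fun _ => by simpa using hasSum_geo_ge q hq0 hq1 0)
  simpa only [Finset.prod_const_one, wt] using h

open Polynomial in
lemma hasSum_fix_i (q : ℝ) (hq0 : 0 < q) (hq1 : q < 1) (n : ℕ) (i : Fin n) :
    Summable (fun w : Fin n → ℕ => if rk w i = i then wt q w else 0) ∧
    HasSum (fun k : ℕ => (1 - q) * q ^ k * ((C (1 - q ^ k) + C (q ^ k) * X) ^ (i : ℕ)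
        * (C (1 - q ^ (k + 1)) + C (q ^ (k + 1)) * X) ^ (n - 1 - i) : ℝ[X]).coeff i)
      (∑' w : Fin n → ℕ, if rk w i = i then wt q w else 0) := by
  have hs : Summable (fun w : Fin n → ℕ => if rk w i = i then wt q w else 0) := by
    refine Summable.of_nonneg_of_le (fun w => ?_) (fun w => ?_) (hasSum_wt q hq0 hq1 n).summable
    · split_ifs
      · exact wt_nonneg q hq0 hq1 w
      · exact le_rfl
    · split_ifs
      · exact le_rfl
      · exact wt_nonneg q hq0 hq1 w
  refine ⟨hs, ?_⟩
  have h := hs.hasSum.tsum_fiberwise (fun w : Fin n → ℕ => w i)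
  have e : (fun k : ℕ => (1 - q) * q ^ k * ((C (1 - q ^ k) + C (q ^ k) * X) ^ (i : ℕ)
        * (C (1 - q ^ (k + 1)) + C (q ^ (k + 1)) * X) ^ (n - 1 - i) : ℝ[X]).coeff i)
      = fun k => ∑' w : ((fun w : Fin n → ℕ => w i) ⁻¹' {k}),
        if rk w.1 i = i then wt q w.1 else 0 := by
    ext k
    rw [← (hasSum_fix_ik q hq0 hq1 n i k).tsum_eq]
    rw [tsum_subtype ((fun w : Fin n → ℕ => w i) ⁻¹' {k})
      (fun w => if rk w i = i then wt q w else 0)]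
    refine tsum_congr fun w => ?_
    by_cases hw : w i = k <;> simp [Set.indicator, hw, wt]
  rw [e]; exact h

lemma hasSum_total (q : ℝ) (hq0 : 0 < q) (hq1 : q < 1) (n : ℕ) :
    HasSum (fun w : Fin n → ℕ => ∑ i, if rk w i = i then wt q w else 0)
      (∑ l ∈ Finset.range n, (1 - q) ^ (l + 1) / (1 - q ^ (l + 1))) := by
  have h1 := hasSum_sum (s := Finset.univ)
    (fun i _ => (hasSum_fix_i q hq0 hq1 n i).1.hasSum)
  have h2 := hasSum_sum (s := Finset.univ) (fun i _ => (hasSum_fix_i q hq0 hq1 n i).2)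
  have h3 : HasSum (fun k : ℕ => ∑ l ∈ Finset.range n, (1 - q) ^ (l + 1) * (q ^ (l + 1)) ^ k)
      (∑ l ∈ Finset.range n, (1 - q) ^ (l + 1) / (1 - q ^ (l + 1))) := by
    refine hasSum_sum fun l _ => ?_
    rw [div_eq_mul_inv]
    exact (hasSum_geometric_of_lt_one (by positivity)
      (pow_lt_one₀ hq0.le hq1 (by omega))).mul_left _
  have e : (fun k : ℕ => ∑ l ∈ Finset.range n, (1 - q) ^ (l + 1) * (q ^ (l + 1)) ^ k)
      = fun k : ℕ => ∑ i : Fin n, (1 - q) * q ^ k * ((Polynomial.C (1 - q ^ k) + Polynomial.C (q ^ k) * Polynomial.X) ^ (i : ℕ)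
        * (Polynomial.C (1 - q ^ (k + 1)) + Polynomial.C (q ^ (k + 1)) * Polynomial.X) ^ (n - 1 - i) : Polynomial ℝ).coeff i := by
    ext k
    rcases n with _ | m
    · simp
    have t := trace_aux (q ^ (k + 1)) (q ^ k * (1 - q)) m
    rw [← Finset.mul_sum, Fin.sum_univ_eq_sum_range (fun i => ((Polynomial.C (1 - q ^ k) + Polynomial.C (q ^ k) * Polynomial.X) ^ i
        * (Polynomial.C (1 - q ^ (k + 1)) + Polynomial.C (q ^ (k + 1)) * Polynomial.X) ^ (m + 1 - 1 - i) : Polynomial ℝ).coeff i)]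
    have ea : (Polynomial.C (1 - q ^ (k + 1)) + Polynomial.C (q ^ (k + 1)) * Polynomial.X : Polynomial ℝ)
      = 1 + Polynomial.C (q ^ (k + 1)) * (Polynomial.X - 1) := by
      simp only [map_sub, Polynomial.C_1]; ring
    have eb : (Polynomial.C (1 - q ^ k) + Polynomial.C (q ^ k) * Polynomial.X : Polynomial ℝ)
      = 1 + Polynomial.C (q ^ (k + 1)) * (Polynomial.X - 1)
        + Polynomial.C (q ^ k * (1 - q)) * (Polynomial.X - 1) := by
      simp only [map_sub, Polynomial.C_1, map_mul, pow_succ]; ring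
    rw [ea, eb, Nat.add_sub_cancel, t, Finset.mul_sum]
    refine Finset.sum_congr rfl fun l _ => ?_
    rw [mul_pow, ← pow_mul, ← pow_mul, pow_succ]
    ring
  rw [e] at h3
  rw [h3.unique h2]
  exact h1

/-- the sorting permutation -/
def sortp {n : ℕ} (w : Fin n → ℕ) : Equiv.Perm (Fin n) :=
  Tuple.sort (fun i => OrderDual.toDual (w i))

lemma sortp_iff {n : ℕ} (w : Fin n → ℕ) (π : Equiv.Perm (Fin n)) :
    sortp w = π ↔ (∀ i j, i ≤ j → w (π j) ≤ w (π i)) ∧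
      ∀ i j, i < j → w (π i) = w (π j) → π i < π j := by
  rw [eq_comm, sortp, Tuple.eq_sort_iff]
  rfl

lemma rk_sortp {n : ℕ} (w : Fin n → ℕ) (m : Fin n) : rk w (sortp w m) = m := by
  obtain ⟨h1, h2⟩ := (sortp_iff w _).1 rfl
  have : (Finset.univ.filter fun j : Fin n => (j < sortp w m ∧ w (sortp w m) ≤ w j) ∨
      (sortp w m < j ∧ w (sortp w m) < w j)) = (Finset.Iio m).map (sortp w).toEmbedding := by
    ext j
    obtain ⟨j, rfl⟩ := (sortp w).surjective j
    simp only [Finset.mem_filter, Finset.mem_univ, true_and, Finset.mem_map_equiv,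
      Equiv.symm_apply_apply, Finset.mem_Iio]
    rcases lt_trichotomy j m with h | h | h
    · have a := h1 j m h.le
      have b := h2 j m h
      simp only [h, iff_true]
      rcases a.lt_or_eq with c | c
      · rcases lt_trichotomy (sortp w j) (sortp w m) with d | d | d
        · exact Or.inl ⟨d, a⟩
        · exact absurd ((sortp w).injective d) h.ne
        · exact Or.inr ⟨d, c⟩
      · exact Or.inl ⟨b c.symm, a⟩
    · subst h; simp
    · have a := h1 m j h.le
      have b := h2 m j h
      simp only [h.not_gt, iff_false]
      rintro (⟨c, d⟩ | ⟨c, d⟩)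
      · exact absurd (b (le_antisymm d a)) c.not_gt
      · omega
  rw [rk, this, Finset.card_map, Fin.card_Iio]

lemma fix_iff {n : ℕ} (w : Fin n → ℕ) (i : Fin n) : sortp w i = i ↔ rk w i = i := by
  constructor
  · intro h
    have := rk_sortp w i
    rwa [h] at this
  · intro h
    obtain ⟨m, rfl⟩ := (sortp w).surjective i
    rw [rk_sortp] at h
    exact congrArg (sortp w) (Fin.ext h).symm

/-- next value -/
def nxt {n : ℕ} (v : Fin n → ℕ) (i : Fin n) : ℕ :=
  if h : i.val + 1 < n then v ⟨i.val + 1, h⟩ else 0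

/-- tail sums -/
def psi {n : ℕ} (d c : Fin n → ℕ) (i : Fin n) : ℕ := ∑ j, if i ≤ j then c j + d j else 0

lemma psi_rec {n : ℕ} (d c : Fin n → ℕ) (i : Fin n) :
    psi d c i = c i + d i + nxt (psi d c) i := by
  have e : nxt (psi d c) i = ∑ j, if i < j then c j + d j else 0 := by
    unfold nxt
    split_ifs with h
    · unfold psi
      refine Finset.sum_congr rfl fun j _ => ?_
      rfl
    · symm
      refine Finset.sum_eq_zero fun j _ => ?_
      rw [if_neg]
      intro hj
      have := j.isLt
      have : i.val < j.val := hj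
      omega
  have e2 : c i + d i = ∑ j, if i = j then c j + d j else 0 := by simp
  rw [e, e2, ← Finset.sum_add_distrib, psi]
  refine Finset.sum_congr rfl fun j _ => ?_
  rcases lt_trichotomy i j with h | h | h
  · simp [h, h.le, h.ne]
  · simp [h]
  · simp [h.not_ge, h.not_gt, h.ne']

lemma psi_unique {n : ℕ} (d c v : Fin n → ℕ) (h : ∀ i, v i = c i + d i + nxt v i) :
    psi d c = v := by
  have : ∀ t : ℕ, ∀ i : Fin n, n - i.val = t → psi d c i = v i := by
    intro t
    induction t with
    | zero => intro i hi; have := i.isLt; omega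
    | succ t ih =>
      intro i hi
      rw [psi_rec, h i]
      congr 1
      unfold nxt
      split_ifs with hh
      · exact ih _ (by simp; omega)
      · rfl
  exact funext fun i => this _ i rfl

lemma psi_injective {n : ℕ} (d : Fin n → ℕ) : Function.Injective (psi d) := by
  intro c c' h
  ext i
  have h1 := psi_rec d c i
  have h2 := psi_rec d c' i
  rw [← h] at h2
  omega

lemma psi_sum {n : ℕ} (d c : Fin n → ℕ) :
    ∑ i, psi d c i = ∑ j : Fin n, (j.val + 1) * c j + ∑ j : Fin n, (j.val + 1) * d j := by
  unfold psi
  rw [Finset.sum_comm, ← Finset.sum_add_distrib]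
  refine Finset.sum_congr rfl fun j _ => ?_
  rw [← Finset.sum_filter, Finset.sum_const]
  have : Finset.univ.filter (fun i : Fin n => i ≤ j) = Finset.Iic j := by ext; simp
  rw [this, Fin.card_Iic, smul_eq_mul]; ring

/-- descent indicator -/
def dsc {n : ℕ} (π : Equiv.Perm (Fin n)) (i : Fin n) : ℕ :=
  if h : i.val + 1 < n then (if π ⟨i.val + 1, h⟩ < π i then 1 else 0) else 0

lemma maj_eq {n : ℕ} (π : Equiv.Perm (Fin n)) : maj π = ∑ j : Fin n, (j.val + 1) * dsc π j := by
  have : ∀ j : Fin n, (j.val + 1) * dsc π j = (fun i : ℕ => if h : i + 1 < n then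
      (if π ⟨i + 1, h⟩ < π ⟨i, Nat.lt_of_succ_lt h⟩ then i + 1 else 0) else 0) j.val := by
    intro j
    unfold dsc
    split_ifs <;> simp_all
  rw [Finset.sum_congr rfl (fun j _ => this j), Fin.sum_univ_eq_sum_range (fun i : ℕ =>
    if h : i + 1 < n then
      (if π ⟨i + 1, h⟩ < π ⟨i, Nat.lt_of_succ_lt h⟩ then i + 1 else 0) else 0)]
  unfold maj wmaj
  refine Finset.sum_subset (Finset.range_mono (Nat.sub_le _ _)) ?_
  intro x _ hx
  rw [dif_neg]
  simp at hx; omega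

lemma sortp_psi {n : ℕ} (π : Equiv.Perm (Fin n)) (c : Fin n → ℕ) :
    sortp (fun i => psi (dsc π) c (π.symm i)) = π := by
  rw [sortp_iff]
  simp only [Equiv.symm_apply_apply]
  have hanti : ∀ i j, i ≤ j → psi (dsc π) c j ≤ psi (dsc π) c i := by
    intro i j hij
    unfold psi
    refine Finset.sum_le_sum fun t _ => ?_
    by_cases h : j ≤ t
    · simp [h, hij.trans h]
    · simp [h]
  refine ⟨hanti, ?_⟩
  have key : ∀ e : ℕ, ∀ i j : Fin n, j.val = i.val + e + 1 →
      psi (dsc π) c i = psi (dsc π) c j → π i < π j := by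
    intro e
    induction e with
    | zero =>
      intro i j hij h
      have hj : j.val < n := j.isLt
      have h' : i.val + 1 < n := by omega
      have ej : j = ⟨i.val + 1, h'⟩ := Fin.ext (by simpa using hij)
      have r := psi_rec (dsc π) c i
      rw [nxt, dif_pos h', ← ej, h] at r
      have d0 : dsc π i = 0 := by omega
      rw [dsc, dif_pos h', ← ej] at d0
      have : ¬ π j < π i := by
        intro hc; simp [hc] at d0
      refine lt_of_le_of_ne (not_lt.1 this) fun hc => ?_
      have := π.injective hc
      rw [this] at hij; omega
    | succ e ih =>
      intro i j hij h
      have hj : j.val < n := j.isLt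
      let p : Fin n := ⟨i.val + 1, by omega⟩
      have hp : p.val = i.val + 1 := rfl
      have a1 := hanti i p (by rw [Fin.le_def]; omega)
      have a2 := hanti p j (by rw [Fin.le_def]; omega)
      refine lt_trans (b := π p) ?_ (ih p j (by omega) (by omega))
      have r := psi_rec (dsc π) c i
      have h' : i.val + 1 < n := by omega
      rw [nxt, dif_pos h'] at r
      change _ = _ + psi (dsc π) c p at r
      have d0 : dsc π i = 0 := by omega
      rw [dsc, dif_pos h'] at d0
      have : ¬ π p < π i := by
        intro hc
        change (if π p < π i then 1 else 0) = 0 at d0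
        simp [hc] at d0
      refine lt_of_le_of_ne (not_lt.1 this) fun hc => ?_
      have := congrArg Fin.val (π.injective hc)
      omega
  intro i j hij
  have : i.val < j.val := hij
  exact key (j.val - i.val - 1) i j (by omega)

lemma mem_range_psi {n : ℕ} (π : Equiv.Perm (Fin n)) (w : Fin n → ℕ) (h : sortp w = π) :
    ∃ c, (fun i => psi (dsc π) c (π.symm i)) = w := by
  obtain ⟨h1, h2⟩ := (sortp_iff w π).1 h
  let v : Fin n → ℕ := fun i => w (π i)
  refine ⟨fun i => v i - dsc π i - nxt v i, ?_⟩
  rw [psi_unique (v := v)]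
  · ext i; simp [v]
  · intro i
    have : dsc π i + nxt v i ≤ v i := by
      unfold dsc nxt
      split_ifs with a b
      · have hi : i < ⟨i.val + 1, a⟩ := by rw [Fin.lt_def]; simp
        have x := h1 _ _ hi.le
        have y := h2 _ _ hi
        have z : w (π i) ≠ w (π ⟨i.val + 1, a⟩) := fun hc => absurd (y hc) b.not_gt
        simp only [v]; omega
      · have hi : i < ⟨i.val + 1, a⟩ := by rw [Fin.lt_def]; simp
        have x := h1 _ _ hi.le
        simp only [v]; omega
      · simp
    omega

lemma hasSum_fiber (q : ℝ) (hq0 : 0 < q) (hq1 : q < 1) (n : ℕ) (π : Equiv.Perm (Fin n)) :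
    HasSum (fun w : Fin n → ℕ => if sortp w = π then wt q w else 0) (q ^ maj π / qfact q n) := by
  let Φ : (Fin n → ℕ) → (Fin n → ℕ) := fun c i => psi (dsc π) c (π.symm i)
  have hinj : Function.Injective Φ := by
    intro c c' h
    apply psi_injective (dsc π)
    ext i
    have := congrFun h (π i)
    simpa [Φ] using this
  refine (hinj.hasSum_iff ?_).1 ?_
  · intro w hw
    rw [if_neg]
    intro h
    exact hw (mem_range_psi π w h)
  · have h := (hasSum_pi_real n (fun j k => (1 - q) * (q ^ (j.val + 1)) ^ k)
      (fun j => (1 - q) * (1 - q ^ (j.val + 1))⁻¹)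
      (fun _ _ => mul_nonneg (by linarith) (by positivity))
      (fun j => (hasSum_geometric_of_lt_one (by positivity)
        (pow_lt_one₀ hq0.le hq1 (by omega))).mul_left _)).mul_left (q ^ maj π)
    have e1 : ((fun w : Fin n → ℕ => if sortp w = π then wt q w else 0) ∘ Φ)
        = fun c => q ^ maj π * ∏ j : Fin n, ((1 - q) * (q ^ (j.val + 1)) ^ c j) := by
      ext c
      have hs : sortp (Φ c) = π := sortp_psi π c
      rw [Function.comp_apply, if_pos hs, wt, Finset.prod_mul_distrib, Finset.prod_mul_distrib,
        Finset.prod_pow_eq_pow_sum]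
      have : ∑ i, Φ c i = ∑ i, psi (dsc π) c i := Equiv.sum_comp π.symm (psi (dsc π) c)
      rw [this, psi_sum, ← maj_eq, pow_add, ← Finset.prod_pow_eq_pow_sum]
      simp only [pow_mul]
      ring
    have e2 : q ^ maj π / qfact q n
        = q ^ maj π * ∏ j : Fin n, ((1 - q) * (1 - q ^ (j.val + 1))⁻¹) := by
      rw [div_eq_mul_inv, qfact, ← Finset.prod_inv_distrib,
        Fin.prod_univ_eq_prod_range (fun j => (1 - q) * (1 - q ^ (j + 1))⁻¹)]
      congr 1
      refine Finset.prod_congr rfl fun j _ => ?_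
      rw [qint, geom_sum_eq hq1.ne, inv_div, ← neg_div_neg_eq, neg_sub, neg_sub, div_eq_mul_inv]
    rw [e1, e2]; exact h

/-- Under `Maj(n,q)` the expected number of fixed points is
`∑_{ℓ=1}^n (1-q)^{ℓ-1} / [ℓ]_q`. -/
theorem expected_fixed_points (q : ℝ) (hq0 : 0 < q) (hq1 : q < 1) (n : ℕ) :
    ∑ π : Equiv.Perm (Fin n),
        (fixedPointCount π : ℝ) * (q ^ maj π / qfact q n)
      = ∑ ℓ ∈ Finset.Icc 1 n, (1 - q) ^ (ℓ - 1) / qint q ℓ := by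
  have h1 := hasSum_sum (s := Finset.univ) (fun π _ =>
    (hasSum_fiber q hq0 hq1 n π).mul_left (fixedPointCount π : ℝ))
  have h2 := hasSum_total q hq0 hq1 n
  have e : (fun w : Fin n → ℕ => ∑ i, if rk w i = i then wt q w else 0)
      = fun w => ∑ π : Equiv.Perm (Fin n),
        (fixedPointCount π : ℝ) * (if sortp w = π then wt q w else 0) := by
    ext w
    simp only [mul_ite, mul_zero, Finset.sum_ite_eq, Finset.mem_univ, if_true]
    simp only [← fix_iff]
    rw [← Finset.sum_filter, Finset.sum_const, fixedPointCount, nsmul_eq_mul]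
  rw [e] at h2
  rw [h1.unique h2, ← Finset.Ico_succ_right_eq_Icc, Finset.sum_Ico_eq_sum_range]
  refine Finset.sum_congr (by simp) fun l _ => ?_
  have hl : 1 + l - 1 = l := by omega
  have hp : q ^ (l + 1) < 1 := pow_lt_one₀ hq0.le hq1 (by omega)
  rw [hl, qint, geom_sum_eq hq1.ne, add_comm 1 l, ← neg_div_neg_eq (q ^ (l + 1) - 1), neg_sub,
    neg_sub, div_div_eq_mul_div, pow_succ]
end
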